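/- arXiv:1508.07734 — 3 statements merged into one kernel-verified Lean document; each statement's English description precedes it below -/
import Mathlib

section
/- Let X be a normal Hausdorff space and let 𝔍 be an ideal in X such that for every null subset A of X the closure cl_X A has a null neighborhood in X. Then C^𝔍_00(X) = C^𝔍_0(X) if and only if 𝔍 is a σ-ideal in X. If moreover X is locally null with respect to 𝔍, these are also equivalent to: every σ-compact subset of λ_𝔍X is contained in a compact subset of λ_𝔍X (in particular, they imply that λ_𝔍X is countably compact). -/
open Set Filter Topology BoundedContinuousFunction

noncomputable section

/-- A (set-theoretic) ideal in a set `X`: a nonempty collection of subsets of `X` closed under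
taking subsets and finite unions. -/
def IsSetIdeal {X : Type*} (I : Set (Set X)) : Prop :=
  I.Nonempty ∧ (∀ A B : Set X, A ⊆ B → B ∈ I → A ∈ I) ∧
    ∀ A B : Set X, A ∈ I → B ∈ I → A ∪ B ∈ I

/-- A σ-ideal: a set ideal further closed under countable unions. -/
def IsSetSigmaIdeal {X : Type*} (I : Set (Set X)) : Prop :=
  IsSetIdeal I ∧ ∀ A : ℕ → Set X, (∀ n, A n ∈ I) → (⋃ n, A n) ∈ I

/-- `A` has a null (i.e. member of `I`) neighborhood in `X`. -/
def HasNullNbhd {X : Type*} [TopologicalSpace X] (I : Set (Set X)) (A : Set X) : Prop :=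
  ∃ U ∈ I, A ⊆ interior U

/-- A cozero-set of `X`. -/
def IsCozeroSet {X : Type*} [TopologicalSpace X] (C : Set X) : Prop :=
  ∃ g : C(X, ℝ), C = {x | g x ≠ 0}

/-- `C^𝔍_00(X)`: bounded continuous functions whose support has a null neighborhood. -/
def CI00 (X : Type*) [TopologicalSpace X] (I : Set (Set X)) : Set (X →ᵇ ℂ) :=
  {f | HasNullNbhd I (closure {x | f x ≠ 0})}

/-- `C^𝔍_0(X)`: bounded continuous functions `f` with `{x : |f x| ≥ 1/n}` null for all `n ≥ 1`. -/
def CI0 (X : Type*) [TopologicalSpace X] (I : Set (Set X)) : Set (X →ᵇ ℂ) :=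
  {f | ∀ n : ℕ, 0 < n → {x | (1 : ℝ) / n ≤ ‖f x‖} ∈ I}

/-- The subspace `λ_𝔍X` of the Stone–Čech compactification `βX`. -/
def lambdaSet (X : Type*) [TopologicalSpace X] (I : Set (Set X)) : Set (StoneCech X) :=
  ⋃ C ∈ {C : Set X | IsCozeroSet C ∧ HasNullNbhd I (closure C)},
    interior (closure (stoneCechUnit '' C))

/-- A set is countably compact if every countable open cover of it has a finite subcover. -/
def IsCountablyCompactSet {α : Type*} [TopologicalSpace α] (s : Set α) : Prop :=
  ∀ U : ℕ → Set α, (∀ n, IsOpen (U n)) → s ⊆ ⋃ n, U n → ∃ t : Finset ℕ, s ⊆ ⋃ n ∈ t, U n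

section Ideal

variable {X : Type*} {I : Set (Set X)}

lemma IsSetIdeal.mono (hI : IsSetIdeal I) {A B : Set X} (hB : B ∈ I) (h : A ⊆ B) : A ∈ I :=
  hI.2.1 A B h hB

lemma IsSetIdeal.empty_mem (hI : IsSetIdeal I) : ∅ ∈ I :=
  let ⟨_, hA⟩ := hI.1
  hI.mono hA (empty_subset _)

lemma IsSetIdeal.biUnion_lt_mem (hI : IsSetIdeal I) {A : ℕ → Set X} (hA : ∀ n, A n ∈ I) (N : ℕ) :
    (⋃ n < N, A n) ∈ I := by
  induction N with
  | zero => simpa using hI.empty_mem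
  | succ N ih => rw [biUnion_lt_succ]; exact hI.2.2 _ _ ih (hA N)

variable [TopologicalSpace X]

lemma HasNullNbhd.mem (hI : IsSetIdeal I) {A : Set X} (h : HasNullNbhd I (closure A)) : A ∈ I :=
  let ⟨_, hU, hAU⟩ := h
  hI.mono hU (subset_closure.trans (hAU.trans interior_subset))

lemma CI00_subset_CI0 (hI : IsSetIdeal I) : CI00 X I ⊆ CI0 X I := by
  intro f hf n hn
  refine hI.mono (HasNullNbhd.mem hI hf) fun x hx => ?_
  have : (0 : ℝ) < 1 / n := by positivity
  exact norm_pos_iff.1 (this.trans_le hx)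

lemma CI0_subset_CI00 (hnbhd : ∀ A ∈ I, HasNullNbhd I (closure A)) (hI : IsSetSigmaIdeal I) :
    CI0 X I ⊆ CI00 X I := by
  intro f hf
  refine hnbhd _ (hI.1.mono (hI.2 _ fun n => hf (n + 1) n.succ_pos) fun x hx => ?_)
  obtain ⟨n, hn⟩ := exists_nat_one_div_lt (norm_pos_iff.2 hx)
  exact mem_iUnion.2 ⟨n, by simpa using hn.le⟩

lemma exists_continuous_one_on_null [NormalSpace X]
    (hnbhd : ∀ A ∈ I, HasNullNbhd I (closure A)) {A : Set X} (hA : A ∈ I) :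
    ∃ U ∈ I, ∃ g : C(X, ℝ), (∀ x ∉ U, g x = 0) ∧ (∀ x ∈ A, g x = 1) ∧
      ∀ x, g x ∈ Icc (0 : ℝ) 1 := by
  obtain ⟨U, hU, hAU⟩ := hnbhd A hA
  obtain ⟨g, h0, h1, h⟩ := exists_continuous_zero_one_of_isClosed
    isOpen_interior.isClosed_compl isClosed_closure (disjoint_compl_left_iff_subset.2 hAU)
  exact ⟨U, hU, g, fun x hx => h0 fun hx' => hx (interior_subset hx'),
    fun x hx => h1 (subset_closure hx), h⟩

lemma isSetSigmaIdeal_of_CI0_subset_CI00 [NormalSpace X] (hI : IsSetIdeal I)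
    (hnbhd : ∀ A ∈ I, HasNullNbhd I (closure A)) (h : CI0 X I ⊆ CI00 X I) :
    IsSetSigmaIdeal I := by
  refine ⟨hI, fun A hA => ?_⟩
  choose U hU g hg0 hg1 hg using fun n => exists_continuous_one_on_null hnbhd (hA n)
  set u : ℕ → ℝ := fun n => (1 / 2) ^ n with hu_def
  have hu : Summable u := summable_geometric_two
  have hu0 : ∀ n, 0 < u n := fun n => by positivity
  have hgu0 : ∀ n x, 0 ≤ g n x * u n := fun n x => mul_nonneg (hg n x).1 (hu0 n).le
  have hgu : ∀ n x, g n x * u n ≤ u n := fun n x =>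
    mul_le_of_le_one_left (hu0 n).le (hg n x).2
  have hgu' : ∀ n x, ‖g n x * u n‖ ≤ u n := fun n x => by
    rw [Real.norm_of_nonneg (hgu0 n x)]; exact hgu n x
  have hs : ∀ x, Summable fun n => g n x * u n := fun x =>
    hu.of_nonneg_of_le (fun n => hgu0 n x) (fun n => hgu n x)
  have hF : Continuous fun x => ∑' n, g n x * u n :=
    continuous_tsum (fun n => by fun_prop) hu hgu'
  have hF0 : ∀ x, 0 ≤ ∑' n, g n x * u n := fun x => tsum_nonneg fun n => hgu0 n x
  have hnorm : ∀ x, ‖((∑' n, g n x * u n : ℝ) : ℂ)‖ = ∑' n, g n x * u n := fun x => by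
    rw [Complex.norm_real, Real.norm_of_nonneg (hF0 x)]
  let f : X →ᵇ ℂ := BoundedContinuousFunction.ofNormedAddCommGroup
    (fun x => ((∑' n, g n x * u n : ℝ) : ℂ)) (Complex.continuous_ofReal.comp hF) (∑' n, u n)
    fun x => by rw [hnorm]; exact (hs x).tsum_le_tsum (fun n => hgu n x) hu
  have hf : f ∈ CI0 X I := by
    intro k hk
    have hk' : (0 : ℝ) < 1 / k := by positivity
    obtain ⟨N, hN⟩ := ((tendsto_sum_nat_add u).eventually_lt_const hk').exists
    refine hI.mono (hI.biUnion_lt_mem hU N) fun x hx => ?_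
    by_contra hxU
    simp only [mem_iUnion, not_exists] at hxU
    refine hN.not_ge (le_trans (b := ∑' n, g n x * u n) ((hnorm x) ▸ hx) ?_)
    rw [← (hs x).sum_add_tsum_nat_add N, Finset.sum_eq_zero, zero_add]
    · exact ((summable_nat_add_iff N).2 (hs x)).tsum_le_tsum (fun n => hgu _ x)
        ((summable_nat_add_iff N).2 hu)
    · intro n hn
      rw [hg0 n x (hxU n (Finset.mem_range.1 hn)), zero_mul]
  refine hI.mono (HasNullNbhd.mem hI (h hf)) fun x hx => ?_
  obtain ⟨n, hn⟩ := mem_iUnion.1 hx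
  have hpos : 0 < ∑' n, g n x * u n :=
    (hs x).tsum_pos (fun n => hgu0 n x) n (by rw [hg1 n x hn, one_mul]; exact hu0 n)
  exact Complex.ofReal_ne_zero.2 hpos.ne'

lemma CI00_eq_CI0_iff [NormalSpace X] (hI : IsSetIdeal I)
    (hnbhd : ∀ A ∈ I, HasNullNbhd I (closure A)) :
    CI00 X I = CI0 X I ↔ IsSetSigmaIdeal I :=
  ⟨fun h => isSetSigmaIdeal_of_CI0_subset_CI00 hI hnbhd h.ge,
    fun h => (CI00_subset_CI0 hI).antisymm (CI0_subset_CI00 hnbhd h)⟩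

/-- In a normal space, `cl_βX A ⊆ λ_𝔍X` for every null set `A`. -/
lemma closure_image_subset_lambdaSet [NormalSpace X] (hI : IsSetIdeal I)
    (hnbhd : ∀ A ∈ I, HasNullNbhd I (closure A)) {A : Set X} (hA : A ∈ I) :
    closure (stoneCechUnit '' A) ⊆ lambdaSet X I := by
  obtain ⟨U, hU, g, hg0, hg1, hg⟩ := exists_continuous_one_on_null hnbhd hA
  have hgc : Continuous fun x => (⟨g x, hg x⟩ : Icc (0 : ℝ) 1) := by fun_prop
  set G : StoneCech X → ℝ := fun p => ((stoneCechExtend hgc p : Icc (0 : ℝ) 1) : ℝ)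
  have hG : Continuous G := continuous_subtype_val.comp (continuous_stoneCechExtend hgc)
  have hGg : ∀ x, G (stoneCechUnit x) = g x := fun x => by simp [G]
  let C : Set X := {x | 1 / 2 < g x}
  have hC : IsCozeroSet C := by
    refine ⟨⟨fun x => max (g x - 1 / 2) 0, by fun_prop⟩, ?_⟩
    ext x
    simp [C]
  have hCU : C ⊆ U := fun x hx => by
    by_contra hxU
    have : 1 / 2 < g x := hx
    rw [hg0 x hxU] at this
    norm_num at this
  refine Subset.trans ?_ (subset_biUnion_of_mem
    (show C ∈ {C : Set X | IsCozeroSet C ∧ HasNullNbhd I (closure C)} from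
      ⟨hC, hnbhd C (hI.mono hU hCU)⟩))
  have hV : IsOpen (G ⁻¹' Ioi (1 / 2)) := isOpen_Ioi.preimage hG
  have h1 : closure (stoneCechUnit '' A) ⊆ G ⁻¹' {1} := by
    refine closure_minimal ?_ (isClosed_singleton.preimage hG)
    rintro _ ⟨x, hx, rfl⟩
    exact (hGg x).trans (hg1 x hx)
  have h2 : G ⁻¹' Ioi (1 / 2) ⊆ closure (stoneCechUnit '' C) := by
    refine (denseRange_stoneCechUnit.open_subset_closure_inter hV).trans (closure_mono ?_)
    rintro _ ⟨hx, x, rfl⟩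
    exact ⟨x, by simpa [hGg, C] using hx, rfl⟩
  refine h1.trans (Subset.trans (fun p hp => ?_) (interior_maximal h2 hV))
  rw [mem_preimage, mem_singleton_iff] at hp
  rw [mem_preimage, hp, mem_Ioi]
  norm_num

lemma IsCompact.exists_null_subset_closure_image (hI : IsSetIdeal I) {K : Set (StoneCech X)}
    (hK : IsCompact K) (h : K ⊆ lambdaSet X I) :
    ∃ A ∈ I, K ⊆ closure (stoneCechUnit '' A) := by
  refine hK.induction_on (p := fun K => ∃ A ∈ I, K ⊆ closure (stoneCechUnit '' A))
    ⟨∅, hI.empty_mem, empty_subset _⟩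
    (fun s t hst ⟨A, hA, ht⟩ => ⟨A, hA, hst.trans ht⟩) ?_ fun p hp => ?_
  · rintro s t ⟨A, hA, hs⟩ ⟨B, hB, ht⟩
    refine ⟨A ∪ B, hI.2.2 A B hA hB, ?_⟩
    rw [image_union, closure_union]
    exact union_subset_union hs ht
  · obtain ⟨C, ⟨-, hC⟩, hpC⟩ := mem_iUnion₂.1 (h hp)
    exact ⟨_, mem_nhdsWithin_of_mem_nhds (isOpen_interior.mem_nhds hpC), C,
      HasNullNbhd.mem hI hC, interior_subset⟩

/-- Over a σ-ideal, σ-compact subsets of `λ_𝔍X` lie in compact subsets of `λ_𝔍X`. -/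
lemma IsSetSigmaIdeal.exists_isCompact_superset [NormalSpace X] (hI : IsSetSigmaIdeal I)
    (hnbhd : ∀ A ∈ I, HasNullNbhd I (closure A)) {K : Set (StoneCech X)}
    (hKI : K ⊆ lambdaSet X I) (hK : IsSigmaCompact K) :
    ∃ L, L ⊆ lambdaSet X I ∧ IsCompact L ∧ K ⊆ L := by
  obtain ⟨S, hS, rfl⟩ := hK
  choose A hA hSA using fun n =>
    (hS n).exists_null_subset_closure_image hI.1 ((subset_iUnion S n).trans hKI)
  exact ⟨closure (stoneCechUnit '' ⋃ n, A n),
    closure_image_subset_lambdaSet hI.1 hnbhd (hI.2 A hA), isClosed_closure.isCompact,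
    iUnion_subset fun n => (hSA n).trans (closure_mono (image_mono (subset_iUnion A n)))⟩

lemma isSetSigmaIdeal_of_exists_isCompact_superset [NormalSpace X] [T2Space X]
    (hI : IsSetIdeal I) (hnbhd : ∀ A ∈ I, HasNullNbhd I (closure A))
    (h : ∀ K ⊆ lambdaSet X I, IsSigmaCompact K →
      ∃ L, L ⊆ lambdaSet X I ∧ IsCompact L ∧ K ⊆ L) :
    IsSetSigmaIdeal I := by
  refine ⟨hI, fun A hA => ?_⟩
  obtain ⟨L, hLI, hL, hAL⟩ := h (⋃ n, closure (stoneCechUnit '' A n))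
    (iUnion_subset fun n => closure_image_subset_lambdaSet hI hnbhd (hA n))
    (isSigmaCompact_iUnion_of_isCompact _ fun n => isClosed_closure.isCompact)
  obtain ⟨B, hB, hLB⟩ := hL.exists_null_subset_closure_image hI hLI
  obtain ⟨U, hU, hBU⟩ := hnbhd B hB
  refine hI.mono hU (iUnion_subset fun n x hx => interior_subset (hBU ?_))
  rw [isInducing_stoneCechUnit.closure_eq_preimage_closure_image]
  exact hLB (hAL (mem_iUnion.2 ⟨n, subset_closure (mem_image_of_mem _ hx)⟩))

end Ideal

lemma isCountablyCompactSet_of_exists_isCompact_superset {α : Type*} [TopologicalSpace α]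
    {s : Set α}
    (h : ∀ K ⊆ s, IsSigmaCompact K → ∃ L, L ⊆ s ∧ IsCompact L ∧ K ⊆ L) :
    IsCountablyCompactSet s := by
  intro U hU hsU
  by_contra! hfin
  choose x hxs hx using fun n => not_subset.1 (hfin (Finset.range n))
  obtain ⟨L, hLs, hL, hxL⟩ := h (⋃ n, {x n})
    (iUnion_subset fun n => singleton_subset_iff.2 (hxs n))
    (isSigmaCompact_iUnion_of_isCompact _ fun n => isCompact_singleton)
  obtain ⟨t, ht⟩ := hL.elim_finite_subcover U hU (hLs.trans hsU)
  obtain ⟨m, hm⟩ := t.exists_nat_subset_range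
  exact hx m (biUnion_mono hm (fun _ _ => Subset.rfl) (ht (hxL (mem_iUnion.2 ⟨m, rfl⟩))))

theorem stmt_2 {X : Type*} [TopologicalSpace X] [NormalSpace X] [T2Space X]
    (𝔍 : Set (Set X)) (hI : IsSetIdeal 𝔍)
    (hnbhd : ∀ A ∈ 𝔍, HasNullNbhd 𝔍 (closure A)) :
    (CI00 X 𝔍 = CI0 X 𝔍 ↔ IsSetSigmaIdeal 𝔍) ∧
    ((∀ x : X, ∃ U ∈ 𝔍, x ∈ interior U) →
      ((CI00 X 𝔍 = CI0 X 𝔍 ↔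
          ∀ K ⊆ lambdaSet X 𝔍, IsSigmaCompact K →
            ∃ L, L ⊆ lambdaSet X 𝔍 ∧ IsCompact L ∧ K ⊆ L) ∧
        (CI00 X 𝔍 = CI0 X 𝔍 → IsCountablyCompactSet (lambdaSet X 𝔍)))) := by
  have hσ := CI00_eq_CI0_iff hI hnbhd
  refine ⟨hσ, fun _ => ⟨⟨fun h K hK hKσ => ?_, fun h => ?_⟩, fun h => ?_⟩⟩
  · exact (hσ.1 h).exists_isCompact_superset hnbhd hK hKσ
  · exact hσ.2 (isSetSigmaIdeal_of_exists_isCompact_superset hI hnbhd h)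
  · exact isCountablyCompactSet_of_exists_isCompact_superset fun K hK hKσ =>
      (hσ.1 h).exists_isCompact_superset hnbhd hK hKσ
end
end

section
/- Let 𝔰_0 = { x ∈ ℓ∞ : for every ε > 0 the series ∑ 1/n over {n ∈ ℕ : |x(n)| ≥ ε} converges } and 𝔰_00 = { x ∈ ℓ∞ : the series ∑ 1/n over {n ∈ ℕ : x(n) ≠ 0} converges }. Then: (1) 𝔰_0 is a closed ideal of ℓ∞; (2) 𝔰_0 has no multiplicative unit; (3) 𝔰_00 ⊆ 𝔰_0 and 𝔰_00 is dense in 𝔰_0; (4) setting S = ⋃{ cl_{βℕ}A : A ⊆ ℕ and ∑_{n∈A} 1/n converges } ⊆ βℕ, the set S is open in βℕ, contains ℕ as a dense subspace, is not compact, and 𝔰_0 is isometrically isomorphic to C_0(S). -/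
open Set Filter Topology BoundedContinuousFunction

noncomputable section

/-- `A ⊆ ℕ` is small: `∑_{n ∈ A} 1/n` converges. -/
def SummableOver (A : Set ℕ) : Prop :=
  Summable fun n : A => (1 : ℝ) / ((n : ℕ) : ℝ)

/-- The ideal `𝔰_00` in `ℓ∞ = C_B(ℕ)`. -/
def s00 : Set (ℕ →ᵇ ℂ) :=
  {x | SummableOver {n : ℕ | x n ≠ 0}}

/-- The ideal `𝔰_0` in `ℓ∞ = C_B(ℕ)`. -/
def s0 : Set (ℕ →ᵇ ℂ) :=
  {x | ∀ ε : ℝ, 0 < ε → SummableOver {n : ℕ | ε ≤ ‖x n‖}}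

/-- The subspace `S` of `βℕ`. -/
def Sset : Set (StoneCech ℕ) :=
  ⋃ A ∈ {A : Set ℕ | SummableOver A}, closure (stoneCechUnit '' A)

lemma summableOver_iff {A : Set ℕ} :
    SummableOver A ↔ Summable (A.indicator fun n : ℕ => (1 : ℝ) / (n : ℝ)) :=
  summable_subtype_iff_indicator (f := fun n : ℕ => (1 : ℝ) / (n : ℝ))

lemma SummableOver.mono {A B : Set ℕ} (hB : SummableOver B) (h : A ⊆ B) : SummableOver A := by
  rw [summableOver_iff] at *
  refine Summable.of_nonneg_of_le (fun n => indicator_nonneg (fun _ _ => by positivity) n)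
    (fun n => ?_) hB
  exact indicator_le_indicator_of_subset h (fun _ => by positivity) n

lemma SummableOver.union {A B : Set ℕ} (hA : SummableOver A) (hB : SummableOver B) :
    SummableOver (A ∪ B) := by
  rw [summableOver_iff] at *
  refine Summable.of_nonneg_of_le (fun n => indicator_nonneg (fun _ _ => by positivity) n)
    (fun n => ?_) (hA.add hB)
  have h : (0 : ℝ) ≤ 1 / (n : ℝ) := by positivity
  by_cases h1 : n ∈ A <;> by_cases h2 : n ∈ B <;> simp_all [Set.indicator]

lemma summableOver_of_finite {A : Set ℕ} (hA : A.Finite) : SummableOver A := by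
  have := hA.to_subtype
  exact Summable.of_finite

lemma not_summableOver_univ : ¬ SummableOver univ := by
  rw [summableOver_iff, indicator_univ]
  exact Real.not_summable_one_div_natCast

lemma s0_add {f g : ℕ →ᵇ ℂ} (hf : f ∈ s0) (hg : g ∈ s0) : f + g ∈ s0 := by
  intro ε hε
  refine ((hf (ε / 2) (by positivity)).union (hg (ε / 2) (by positivity))).mono fun n hn => ?_
  by_contra h
  simp only [mem_union, mem_ofPred_eq, not_or, not_le] at h hn
  have := norm_add_le (f n) (g n)
  simp only [BoundedContinuousFunction.coe_add, Pi.add_apply] at hn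
  linarith

lemma s0_mul_left (c : ℕ →ᵇ ℂ) {f : ℕ →ᵇ ℂ} (hf : f ∈ s0) : c * f ∈ s0 := by
  intro ε hε
  have hc : 0 < ‖c‖ + 1 := by positivity
  refine (hf (ε / (‖c‖ + 1)) (by positivity)).mono fun n hn => ?_
  simp only [mem_ofPred_eq, BoundedContinuousFunction.coe_mul, Pi.mul_apply, norm_mul] at hn ⊢
  rw [div_le_iff₀ hc, mul_comm]
  exact hn.trans (mul_le_mul_of_nonneg_right ((c.norm_coe_le_norm n).trans (by linarith))
    (norm_nonneg _))

/-- The ideal of `ℓ∞` with underlying set `s0`. -/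
def s0Ideal : Ideal (ℕ →ᵇ ℂ) where
  carrier := s0
  add_mem' := s0_add
  zero_mem' := fun ε hε => summableOver_of_finite (by simp [not_le.2 hε])
  smul_mem' := fun c _ hf => s0_mul_left c hf

lemma isClosed_s0 : IsClosed s0 := by
  refine isClosed_of_closure_subset fun f hf ε hε => ?_
  obtain ⟨g, hg, hfg⟩ := Metric.mem_closure_iff.1 hf (ε / 2) (by positivity)
  refine (hg (ε / 2) (by positivity)).mono fun n hn => ?_
  simp only [mem_ofPred_eq] at hn ⊢
  have h1 := (f.dist_coe_le_dist (g := g) n).trans hfg.le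
  rw [dist_eq_norm] at h1
  have h2 := norm_sub_norm_le (f n) (g n)
  linarith

/-- The product of `f` with the indicator function of `A`. -/
def restrictTo (A : Set ℕ) (f : ℕ →ᵇ ℂ) : ℕ →ᵇ ℂ :=
  BoundedContinuousFunction.ofNormedAddCommGroup (A.indicator f) continuous_of_discreteTopology
    ‖f‖ fun n => (norm_indicator_le_norm_self _ _).trans (f.norm_coe_le_norm n)

lemma restrictTo_apply (A : Set ℕ) (f : ℕ →ᵇ ℂ) (n : ℕ) :
    restrictTo A f n = A.indicator f n := rfl

lemma s00_subset_s0 : s00 ⊆ s0 := fun _ hf _ hε =>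
  SummableOver.mono hf fun _ hn => norm_pos_iff.1 (hε.trans_le hn)

lemma restrictTo_mem_s00 {A : Set ℕ} (hA : SummableOver A) (f : ℕ →ᵇ ℂ) :
    restrictTo A f ∈ s00 :=
  hA.mono fun n hn => by
    by_contra h
    exact hn (by rw [restrictTo_apply, indicator_of_notMem h])

lemma s0_subset_closure_s00 : s0 ⊆ closure s00 := by
  intro f hf
  refine Metric.mem_closure_iff.2 fun ε hε => ?_
  refine ⟨_, restrictTo_mem_s00 (hf (ε / 2) (by positivity)) f, ?_⟩
  refine lt_of_le_of_lt ?_ (half_lt_self hε)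
  refine (BoundedContinuousFunction.dist_le (by positivity)).2 fun n => ?_
  rw [restrictTo_apply, dist_eq_norm]
  by_cases h : ε / 2 ≤ ‖f n‖
  · rw [indicator_of_mem (by exact h), sub_self, norm_zero]
    positivity
  · rw [indicator_of_notMem (by exact h), sub_zero]
    exact (not_le.1 h).le

lemma s0_no_unit : ¬ ∃ u ∈ s0, ∀ f ∈ s0, u * f = f := by
  rintro ⟨u, hu, h⟩
  refine not_summableOver_univ ((hu 1 one_pos).mono fun n _ => ?_)
  have hn := DFunLike.congr_fun (h _ (s00_subset_s0 (restrictTo_mem_s00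
    (summableOver_of_finite (finite_singleton n)) 1))) n
  simp only [BoundedContinuousFunction.coe_mul, Pi.mul_apply, restrictTo_apply] at hn
  simp only [mem_singleton_iff, indicator_of_mem, BoundedContinuousFunction.coe_one,
    Pi.one_apply, mul_one] at hn
  simp [hn]

/-- The closure of `A` in `βℕ` is open (hence clopen), and its trace on `ℕ` is `A`. -/
lemma isOpen_closure_and_mem_iff (A : Set ℕ) :
    IsOpen (closure ((stoneCechUnit : ℕ → StoneCech ℕ) '' A)) ∧
      ∀ n : ℕ, (stoneCechUnit n : StoneCech ℕ) ∈ closure (stoneCechUnit '' A) ↔ n ∈ A := by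
  classical
  let χ : ℕ → Bool := fun n => decide (n ∈ A)
  have hχ : Continuous χ := continuous_of_discreteTopology
  have hc : Continuous (stoneCechExtend hχ) := continuous_stoneCechExtend hχ
  have hu : ∀ n, stoneCechExtend hχ (stoneCechUnit n) = χ n := stoneCechExtend_stoneCechUnit hχ
  have hU : IsClopen (stoneCechExtend hχ ⁻¹' {true}) := (isClopen_discrete _).preimage hc
  have key : closure ((stoneCechUnit : ℕ → StoneCech ℕ) '' A) =
      stoneCechExtend hχ ⁻¹' {true} := by
    refine Subset.antisymm (closure_minimal ?_ hU.1) ?_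
    · rintro _ ⟨n, hn, rfl⟩
      simpa [hu, χ] using hn
    · refine (denseRange_stoneCechUnit.open_subset_closure_inter hU.2).trans (closure_mono ?_)
      rintro _ ⟨hy, n, rfl⟩
      exact ⟨n, by simpa [hu, χ] using hy, rfl⟩
  rw [key]
  exact ⟨hU.2, fun n => by simp [hu, χ]⟩

lemma isOpen_Sset : IsOpen Sset :=
  isOpen_biUnion fun A _ => (isOpen_closure_and_mem_iff A).1

lemma closure_subset_Sset {A : Set ℕ} (hA : SummableOver A) :
    closure (stoneCechUnit '' A) ⊆ Sset :=
  subset_biUnion_of_mem (u := fun A : Set ℕ => closure (stoneCechUnit '' A)) hA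

lemma stoneCechUnit_mem_Sset (n : ℕ) : (stoneCechUnit n : StoneCech ℕ) ∈ Sset :=
  closure_subset_Sset (summableOver_of_finite (finite_singleton n))
    (subset_closure (mem_image_of_mem _ rfl))

lemma exists_summableOver_of_isCompact {K : Set (StoneCech ℕ)} (hK : IsCompact K)
    (hKS : K ⊆ Sset) : ∃ A : Set ℕ, SummableOver A ∧ K ⊆ closure (stoneCechUnit '' A) := by
  have hne : Nonempty {A : Set ℕ // SummableOver A} := ⟨⟨∅, summableOver_of_finite finite_empty⟩⟩
  obtain ⟨A, hA⟩ := hK.elim_directed_cover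
    (fun A : {A : Set ℕ // SummableOver A} => closure (stoneCechUnit '' A.1))
    (fun A => (isOpen_closure_and_mem_iff A.1).1)
    (fun y hy => by
      obtain ⟨A, hA, hy⟩ := mem_iUnion₂.1 (hKS hy)
      exact mem_iUnion.2 ⟨⟨A, hA⟩, hy⟩)
    (fun A B => ⟨⟨A.1 ∪ B.1, A.2.union B.2⟩,
      closure_mono (image_mono subset_union_left),
      closure_mono (image_mono subset_union_right)⟩)
  exact ⟨A.1, A.2, hA⟩

lemma not_isCompact_Sset : ¬ IsCompact Sset := by
  intro h
  obtain ⟨A, hA, hS⟩ := exists_summableOver_of_isCompact h Subset.rfl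
  exact not_summableOver_univ (hA.mono fun n _ =>
    ((isOpen_closure_and_mem_iff A).2 n).1 (hS (stoneCechUnit_mem_Sset n)))

/-- The inclusion of `ℕ` into `Sset`. -/
def unitS (n : ℕ) : ↥Sset := ⟨stoneCechUnit n, stoneCechUnit_mem_Sset n⟩

lemma denseRange_unitS : DenseRange unitS := by
  intro y
  rw [closure_subtype, ← range_comp]
  have h := denseRange_stoneCechUnit (α := ℕ) y.1
  exact h

lemma exists_extension (f : ℕ →ᵇ ℂ) :
    ∃ g : C(StoneCech ℕ, ℂ), ∀ n : ℕ, g (stoneCechUnit n) = f n := by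
  have : CompactSpace (Metric.closedBall (0 : ℂ) ‖f‖) :=
    isCompact_iff_compactSpace.1 (isCompact_closedBall _ _)
  let F : ℕ → Metric.closedBall (0 : ℂ) ‖f‖ := fun n =>
    ⟨f n, by simpa using f.norm_coe_le_norm n⟩
  have hF : Continuous F := continuous_of_discreteTopology
  refine ⟨⟨fun y => (stoneCechExtend hF y).1,
    continuous_subtype_val.comp (continuous_stoneCechExtend hF)⟩, fun n => ?_⟩
  simp [stoneCechExtend_stoneCechUnit hF, F]

/-- The continuous extension of a bounded sequence to `Sset`. -/
def extendS (f : ℕ →ᵇ ℂ) : ↥Sset →ᵇ ℂ :=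
  (BoundedContinuousFunction.mkOfCompact (exists_extension f).choose).compContinuous
    ⟨Subtype.val, continuous_subtype_val⟩

@[simp]
lemma extendS_unitS (f : ℕ →ᵇ ℂ) (n : ℕ) : extendS f (unitS n) = f n :=
  (exists_extension f).choose_spec n

lemma eq_of_unitS {g h : ↥Sset →ᵇ ℂ} (H : ∀ n, g (unitS n) = h (unitS n)) : g = h :=
  DFunLike.coe_injective (denseRange_unitS.equalizer g.continuous h.continuous (funext H))

lemma norm_extendS (f : ℕ →ᵇ ℂ) : ‖extendS f‖ = ‖f‖ := by
  apply le_antisymm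
  · refine (BoundedContinuousFunction.norm_le (norm_nonneg _)).2 fun y => ?_
    refine denseRange_unitS.induction_on y
      (isClosed_le (extendS f).continuous.norm continuous_const) fun n => ?_
    rw [extendS_unitS]
    exact f.norm_coe_le_norm n
  · refine (BoundedContinuousFunction.norm_le (norm_nonneg _)).2 fun n => ?_
    rw [← extendS_unitS]
    exact (extendS f).norm_coe_le_norm _

lemma tendsto_extendS {f : ℕ →ᵇ ℂ} (hf : f ∈ s0) :
    Tendsto (extendS f) (cocompact _) (𝓝 0) := by
  refine Metric.tendsto_nhds.2 fun ε hε => ?_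
  have hA := hf (ε / 2) (by positivity)
  set A := {n : ℕ | ε / 2 ≤ ‖f n‖}
  have hK : IsCompact ((↑) ⁻¹' closure (stoneCechUnit '' A) : Set ↥Sset) := by
    rw [Subtype.isCompact_iff, Subtype.image_preimage_coe,
      inter_eq_right.2 (closure_subset_Sset hA)]
    exact isClosed_closure.isCompact
  refine mem_cocompact.2 ⟨_, hK, fun y hy => ?_⟩
  by_contra hlt
  simp only [mem_ofPred_eq, dist_zero_right, not_lt] at hlt
  refine hy ?_
  have hU : IsOpen {z : ↥Sset | ε / 2 < ‖extendS f z‖} :=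
    isOpen_lt continuous_const (extendS f).continuous.norm
  have hy' : y ∈ closure ({z : ↥Sset | ε / 2 < ‖extendS f z‖} ∩ range unitS) :=
    denseRange_unitS.open_subset_closure_inter hU (by simp only [mem_ofPred_eq]; linarith)
  refine closure_minimal ?_ (isClosed_closure.preimage continuous_subtype_val) hy'
  rintro _ ⟨hz, n, rfl⟩
  rw [mem_ofPred_eq, extendS_unitS] at hz
  exact subset_closure ⟨n, hz.le, rfl⟩

lemma exists_extendS_eq {g : ↥Sset →ᵇ ℂ} (hg : Tendsto g (cocompact _) (𝓝 0)) :
    ∃ f ∈ s0, extendS f = g := by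
  refine ⟨g.compContinuous ⟨unitS, continuous_of_discreteTopology⟩, fun ε hε => ?_,
    eq_of_unitS fun n => by simp⟩
  obtain ⟨K, hK, hKg⟩ := mem_cocompact.1 (Metric.tendsto_nhds.1 hg ε hε)
  obtain ⟨A, hA, hKA⟩ := exists_summableOver_of_isCompact (hK.image continuous_subtype_val)
    (by rintro _ ⟨y, -, rfl⟩; exact y.2)
  refine hA.mono fun n hn => ((isOpen_closure_and_mem_iff A).2 n).1 (hKA ⟨unitS n, ?_, rfl⟩)
  by_contra h
  have hlt : dist (g (unitS n)) 0 < ε := hKg h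
  rw [dist_zero_right] at hlt
  exact not_le.2 hlt hn

theorem stmt_5 :
    -- (1) `𝔰_0` is a closed ideal of `ℓ∞`
    ((∃ I : Ideal (ℕ →ᵇ ℂ), (I : Set (ℕ →ᵇ ℂ)) = s0) ∧ IsClosed s0) ∧
    -- (2) `𝔰_0` has no multiplicative unit
    (¬ ∃ u ∈ s0, ∀ f ∈ s0, u * f = f) ∧
    -- (3) `𝔰_00 ⊆ 𝔰_0` and `𝔰_00` is dense in `𝔰_0`
    (s00 ⊆ s0 ∧ s0 ⊆ closure s00) ∧
    -- (4) `S` is open in `βℕ`, contains `ℕ` densely, is not compact, and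
    --     `𝔰_0` is isometrically isomorphic to `C_0(S)`
    (IsOpen Sset ∧
      Set.range (stoneCechUnit : ℕ → StoneCech ℕ) ⊆ Sset ∧
      Dense {y : ↥Sset |
        (y : StoneCech ℕ) ∈ Set.range (stoneCechUnit : ℕ → StoneCech ℕ)} ∧
      ¬ IsCompact Sset ∧
      ∃ Φ : (ℕ →ᵇ ℂ) → (↥Sset →ᵇ ℂ),
        (∀ f ∈ s0, Filter.Tendsto (Φ f : ↥Sset → ℂ) (Filter.cocompact _) (nhds 0)) ∧
        (∀ g : ↥Sset →ᵇ ℂ, Filter.Tendsto (g : ↥Sset → ℂ) (Filter.cocompact _) (nhds 0) →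
          ∃ f ∈ s0, Φ f = g) ∧
        (∀ f ∈ s0, ∀ g ∈ s0, Φ f = Φ g → f = g) ∧
        (∀ f ∈ s0, ∀ g ∈ s0, Φ (f + g) = Φ f + Φ g) ∧
        (∀ f ∈ s0, ∀ g ∈ s0, Φ (f * g) = Φ f * Φ g) ∧
        (∀ (c : ℂ), ∀ f ∈ s0, Φ (c • f) = c • Φ f) ∧
        (∀ f ∈ s0, ‖Φ f‖ = ‖f‖)) := by
  refine ⟨⟨⟨s0Ideal, rfl⟩, isClosed_s0⟩, s0_no_unit, ⟨s00_subset_s0, s0_subset_closure_s00⟩,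
    isOpen_Sset, ?_, ?_, not_isCompact_Sset, extendS, fun f hf => tendsto_extendS hf,
    fun g hg => exists_extendS_eq hg, ?_, ?_, ?_, ?_, fun f _ => norm_extendS f⟩
  · rintro _ ⟨n, rfl⟩
    exact stoneCechUnit_mem_Sset n
  · refine denseRange_unitS.mono ?_
    rintro _ ⟨n, rfl⟩
    exact ⟨n, rfl⟩
  · intro f _ g _ h
    ext n
    rw [← extendS_unitS f, h, extendS_unitS]
  · exact fun f _ g _ => eq_of_unitS fun n => by simp
  · exact fun f _ g _ => eq_of_unitS fun n => by simp
  · exact fun c f _ => eq_of_unitS fun n => by simp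
end
end

section
/- Let X be a Tychonoff (completely regular Hausdorff) space and let H be a non-vanishing closed ideal of C_B(X). The following are equivalent: (1) every σ-compact subset of λ_H X is contained in a compact subset of λ_H X (in particular λ_H X is countably compact); (2) every continuous function λ_H X → ℂ vanishing at infinity has compact support, i.e., C_00(λ_H X) = C_0(λ_H X); (3) H = ⋃_{h∈H} Ann(h − 1), where 1 denotes the constant function one on X and Ann(g) = {f ∈ C_B(X) : f·g = 0}. -/
open Set Filter Topology BoundedContinuousFunction

noncomputable section

/-- The subspace `λ_H X = ⋃_{h ∈ H} cl_{βX} {x : |h x| > 1}` of `βX`. -/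
def lambdaH {X : Type*} [TopologicalSpace X] (H : Set (X →ᵇ ℂ)) : Set (StoneCech X) :=
  ⋃ h ∈ H, closure (stoneCechUnit '' {x : X | 1 < ‖h x‖})

section OpenSubsets

variable {K : Type*} [TopologicalSpace K]

theorem isCompact_preimage_subtypeVal {U Z : Set K} (hZ : IsCompact Z) (hZU : Z ⊆ U) :
    IsCompact (Subtype.val ⁻¹' Z : Set U) :=
  (IsInducing.subtypeVal.isCompact_preimage_iff (by simpa using hZU)).2 hZ

theorem isCountablyCompactSet_of_isSigmaCompact {U : Set K}
    (h : ∀ S ⊆ U, IsSigmaCompact S → ∃ L, L ⊆ U ∧ IsCompact L ∧ S ⊆ L) :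
    IsCountablyCompactSet U := by
  intro V hV hUV
  by_contra! hcon
  have hex : ∀ n, ∃ x ∈ U, ∀ k ≤ n, x ∉ V k := fun n ↦ by
    obtain ⟨x, hxU, hx⟩ := not_subset.1 (hcon (Finset.range (n + 1)))
    simp only [mem_iUnion, Finset.mem_range, not_exists] at hx
    exact ⟨x, hxU, fun k hk ↦ hx k (by omega)⟩
  choose x hxU hx using hex
  have hσ : IsSigmaCompact (range x) := by
    rw [← iUnion_singleton_eq_range]
    exact isSigmaCompact_iUnion_of_isCompact _ fun _ ↦ isCompact_singleton
  obtain ⟨L, hLU, hL, hxL⟩ := h _ (range_subset_iff.2 hxU) hσ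
  obtain ⟨t, ht⟩ := hL.elim_finite_subcover V hV (hLU.trans hUV)
  obtain ⟨k, hk, hxk⟩ := mem_iUnion₂.1 (ht (hxL (mem_range_self (t.sup id))))
  exact hx _ k (Finset.le_sup (f := id) hk) hxk

theorem tendsto_cocompact_of_eq_zero_off [CompactSpace K] {U : Set K} {f : C(K, ℂ)}
    (hf : ∀ x ∉ U, f x = 0) :
    Tendsto (fun x : U ↦ f x) (cocompact U) (𝓝 0) := by
  rw [Metric.tendsto_nhds]
  intro ε hε
  have hZ : IsCompact {x : K | ε ≤ ‖f x‖} :=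
    (isClosed_le continuous_const f.continuous.norm).isCompact
  have hZU : {x : K | ε ≤ ‖f x‖} ⊆ U := fun x hx ↦ by
    by_contra hxU
    rw [mem_ofPred_eq, hf x hxU, norm_zero] at hx
    exact hε.not_ge hx
  refine mem_cocompact.2 ⟨_, isCompact_preimage_subtypeVal hZ hZU, fun x hx ↦ ?_⟩
  simpa using hx

variable [T2Space K]

/-- Extension by zero of a function vanishing at infinity on an open subset. -/
theorem exists_extension_of_tendsto_cocompact {U : Set K} (hU : IsOpen U) (g : C(U, ℂ))
    (hg : Tendsto g (cocompact U) (𝓝 0)) :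
    ∃ f : C(K, ℂ), (∀ x : U, f x = g x) ∧ ∀ x ∉ U, f x = 0 := by
  have hext : ∀ x : U, Function.extend Subtype.val g 0 (x : K) = g x := fun x ↦
    Subtype.val_injective.extend_apply g 0 x
  have hzero : ∀ x ∉ U, Function.extend Subtype.val g 0 x = 0 := fun x hx ↦
    Function.extend_apply' _ _ _ (by rintro ⟨y, rfl⟩; exact hx y.2)
  refine ⟨⟨Function.extend Subtype.val g 0, ?_⟩, hext, hzero⟩
  rw [continuous_iff_continuousAt]
  intro p
  by_cases hp : p ∈ U
  · have h := hU.isOpenEmbedding_subtypeVal.continuousAt_iff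
      (f := Subtype.val) (g := Function.extend Subtype.val g 0) (x := (⟨p, hp⟩ : U))
    refine h.1 ?_
    rw [show Function.extend Subtype.val g 0 ∘ Subtype.val = g from funext hext]
    exact g.continuous.continuousAt
  · rw [ContinuousAt, hzero p hp, Metric.tendsto_nhds]
    intro ε hε
    obtain ⟨C, hC, hCε⟩ := mem_cocompact.1 (Metric.tendsto_nhds.1 hg ε hε)
    have hC' : IsClosed (Subtype.val '' C : Set K) :=
      (hC.image continuous_subtype_val).isClosed
    have hpC : p ∉ (Subtype.val '' C : Set K) := by
      rintro ⟨y, -, rfl⟩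
      exact hp y.2
    filter_upwards [hC'.isOpen_compl.mem_nhds hpC] with q hq
    by_cases hqU : q ∈ U
    · rw [hext ⟨q, hqU⟩]
      exact hCε fun hqC ↦ hq ⟨_, hqC, rfl⟩
    · rw [hzero q hqU, dist_self]
      exact hε

variable [CompactSpace K]

theorem exists_eqOn_one_of_isCompact {U L : Set K} (hU : IsOpen U) (hL : IsCompact L)
    (hLU : L ⊆ U) : ∃ f : C(K, ℝ), EqOn f 1 L ∧ (∀ x ∉ U, f x = 0) ∧ ∀ x, f x ∈ Icc (0 : ℝ) 1 := by
  obtain ⟨f, h0, h1, h01⟩ := exists_continuous_zero_one_of_isClosed hU.isClosed_compl hL.isClosed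
    (disjoint_compl_left_iff_subset.2 hLU)
  exact ⟨f, h1, fun x hx ↦ h0 hx, h01⟩

theorem exists_mul_sub_one_eq_zero_of_isSigmaCompact {U : Set K} (hU : IsOpen U)
    (h : ∀ S ⊆ U, IsSigmaCompact S → ∃ L, L ⊆ U ∧ IsCompact L ∧ S ⊆ L)
    {f : C(K, ℂ)} (hf : ∀ x ∉ U, f x = 0) :
    ∃ g : C(K, ℂ), (∀ x ∉ U, g x = 0) ∧ f * (g - 1) = 0 := by
  have hσ : IsSigmaCompact (⋃ n : ℕ, {x | 1 / ((n : ℝ) + 1) ≤ ‖f x‖}) :=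
    isSigmaCompact_iUnion_of_isCompact _ fun n ↦
      (isClosed_le continuous_const f.continuous.norm).isCompact
  have hsub : (⋃ n : ℕ, {x | 1 / ((n : ℝ) + 1) ≤ ‖f x‖}) ⊆ U := iUnion_subset fun n x hx ↦ by
    by_contra hxU
    rw [mem_ofPred_eq, hf x hxU, norm_zero] at hx
    exact (Nat.one_div_pos_of_nat (α := ℝ)).not_ge hx
  obtain ⟨L, hLU, hL, hfL⟩ := h _ hsub hσ
  obtain ⟨g, hg1, hg0, -⟩ := exists_eqOn_one_of_isCompact hU hL hLU
  refine ⟨⟨fun x ↦ (g x : ℂ), by fun_prop⟩, fun x hx ↦ by simp [hg0 x hx], ?_⟩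
  ext x
  by_cases hx : f x = 0
  · simp [hx]
  · obtain ⟨n, hn⟩ := exists_nat_one_div_lt (norm_pos_iff.2 hx)
    have hgx : g x = 1 := hg1 (hfL (mem_iUnion.2 ⟨n, hn.le⟩))
    simp [hgx]

theorem hasCompactSupport_of_exists_mul_sub_one_eq_zero {U : Set K} (hU : IsOpen U)
    (h : ∀ f : C(K, ℂ), (∀ x ∉ U, f x = 0) →
      ∃ g : C(K, ℂ), (∀ x ∉ U, g x = 0) ∧ f * (g - 1) = 0)
    (k : C(U, ℂ)) (hk : Tendsto k (cocompact U) (𝓝 0)) : HasCompactSupport k := by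
  obtain ⟨f, hfk, hf⟩ := exists_extension_of_tendsto_cocompact hU k hk
  obtain ⟨g, hg, hfg⟩ := h f hf
  have hZ : IsCompact {x : K | g x = 1} :=
    (isClosed_eq g.continuous continuous_const).isCompact
  have hZU : {x : K | g x = 1} ⊆ U := fun x hx ↦ by
    by_contra hxU
    rw [mem_ofPred_eq, hg x hxU] at hx
    exact zero_ne_one hx
  refine HasCompactSupport.intro (isCompact_preimage_subtypeVal hZ hZU) fun x hx ↦ ?_
  have hx' : f x * (g x - 1) = 0 := DFunLike.congr_fun hfg (x : K)
  rw [← hfk]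
  exact (mul_eq_zero.1 hx').resolve_right fun h0 ↦ hx (sub_eq_zero.1 h0)

theorem exists_isCompact_superset_of_hasCompactSupport {U : Set K} (hU : IsOpen U)
    (h : ∀ k : C(U, ℂ), Tendsto k (cocompact U) (𝓝 0) → HasCompactSupport k)
    {S : Set K} (hSU : S ⊆ U) (hS : IsSigmaCompact S) :
    ∃ L, L ⊆ U ∧ IsCompact L ∧ S ⊆ L := by
  obtain ⟨C, hC, rfl⟩ := hS
  choose g hg1 hg0 hg01 using fun n ↦
    exists_eqOn_one_of_isCompact hU (hC n) ((subset_iUnion C n).trans hSU)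
  have hbound : ∀ n x, ‖(1 / 2 : ℝ) ^ n * g n x‖ ≤ (1 / 2 : ℝ) ^ n := fun n x ↦ by
    rw [Real.norm_of_nonneg (mul_nonneg (by positivity) (hg01 n x).1)]
    exact mul_le_of_le_one_right (by positivity) (hg01 n x).2
  have hsum : ∀ x, Summable fun n ↦ (1 / 2 : ℝ) ^ n * g n x := fun x ↦
    Summable.of_norm_bounded summable_geometric_two fun n ↦ hbound n x
  have hcont : Continuous fun x ↦ ∑' n, (1 / 2 : ℝ) ^ n * g n x :=
    continuous_tsum (fun n ↦ by fun_prop) summable_geometric_two hbound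
  let f : C(K, ℂ) := ⟨fun x ↦ ((∑' n, (1 / 2 : ℝ) ^ n * g n x : ℝ) : ℂ),
    Complex.continuous_ofReal.comp hcont⟩
  have hf0 : ∀ x ∉ U, f x = 0 := fun x hx ↦ by simp [f, hg0 _ x hx]
  have hfC : ∀ n, ∀ x ∈ C n, f x ≠ 0 := fun n x hx ↦ by
    have hpos : 0 < ∑' n, (1 / 2 : ℝ) ^ n * g n x :=
      (hsum x).tsum_pos (fun m ↦ mul_nonneg (by positivity) (hg01 m x).1) n
        (by rw [hg1 n hx]; simp)
    exact Complex.ofReal_ne_zero.2 hpos.ne'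
  have hsupp := h (f.restrict U) (tendsto_cocompact_of_eq_zero_off hf0)
  refine ⟨Subtype.val '' tsupport (f.restrict U), Subtype.coe_image_subset _ _,
    hsupp.isCompact.image continuous_subtype_val, fun x hx ↦ ?_⟩
  obtain ⟨n, hn⟩ := mem_iUnion.1 hx
  exact ⟨⟨x, hSU hx⟩, subset_tsupport _ (hfC n x hn), rfl⟩

end OpenSubsets

section StoneCech

variable {X : Type*} [TopologicalSpace X]

/-- Restriction of continuous functions on `StoneCech X` to bounded continuous functions on `X`. -/
def stoneCechRestrict (X : Type*) [TopologicalSpace X] : C(StoneCech X, ℂ) →+* (X →ᵇ ℂ) where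
  toFun g := (mkOfCompact g).compContinuous ⟨stoneCechUnit, continuous_stoneCechUnit⟩
  map_one' := rfl
  map_mul' _ _ := rfl
  map_zero' := rfl
  map_add' _ _ := rfl

@[simp]
theorem stoneCechRestrict_apply (g : C(StoneCech X, ℂ)) (x : X) :
    stoneCechRestrict X g x = g (stoneCechUnit x) := rfl

theorem stoneCechRestrict_injective : Function.Injective (stoneCechRestrict X) := fun f g h ↦
  DFunLike.coe_injective <| stoneCech_hom_ext f.continuous g.continuous <|
    funext fun x ↦ DFunLike.congr_fun h x

theorem stoneCechRestrict_surjective : Function.Surjective (stoneCechRestrict X) := fun f ↦ by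
  have hmem : ∀ x, f x ∈ Metric.closedBall (0 : ℂ) ‖f‖ := fun x ↦ by
    simpa using f.norm_coe_le_norm x
  have : CompactSpace (Metric.closedBall (0 : ℂ) ‖f‖) :=
    isCompact_iff_compactSpace.1 (isCompact_closedBall _ _)
  have hc : Continuous (codRestrict f _ hmem) := f.continuous.codRestrict hmem
  refine ⟨⟨fun p ↦ (stoneCechExtend hc p).1,
    continuous_subtype_val.comp (continuous_stoneCechExtend hc)⟩, ?_⟩
  ext1 x
  simp

theorem continuous_stoneCechRestrict : Continuous (stoneCechRestrict X) :=
  (continuous_compContinuous ⟨stoneCechUnit, continuous_stoneCechUnit⟩).comp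
    (ContinuousMap.isometryEquivBoundedOfCompact (StoneCech X) ℂ).continuous

theorem lambdaH_eq_setOfIdeal (H : Ideal (X →ᵇ ℂ)) :
    lambdaH (H : Set (X →ᵇ ℂ)) = ContinuousMap.setOfIdeal (H.comap (stoneCechRestrict X)) := by
  ext p
  simp only [lambdaH, mem_iUnion, SetLike.mem_coe, ContinuousMap.mem_setOfIdeal, exists_prop,
    Ideal.mem_comap]
  constructor
  · rintro ⟨h, hH, hp⟩
    obtain ⟨g, rfl⟩ := stoneCechRestrict_surjective h
    refine ⟨g, hH, fun hgp ↦ ?_⟩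
    have hsub : closure (stoneCechUnit '' {x : X | 1 < ‖stoneCechRestrict X g x‖}) ⊆
        {q | 1 ≤ ‖g q‖} :=
      closure_minimal (image_subset_iff.2 fun x (hx : 1 < ‖_‖) ↦ hx.le)
        (isClosed_le continuous_const g.continuous.norm)
    have := hsub hp
    rw [mem_ofPred_eq, hgp, norm_zero] at this
    exact zero_lt_one.not_ge this
  · rintro ⟨g, hgH, hgp⟩
    let k : C(StoneCech X, ℂ) := ContinuousMap.const _ (2 / g p) * g
    refine ⟨stoneCechRestrict X k, ?_, ?_⟩
    · rw [map_mul]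
      exact H.mul_mem_left _ hgH
    · have hk : IsOpen {q | 1 < ‖k q‖} := isOpen_lt continuous_const k.continuous.norm
      have hpk : p ∈ {q | 1 < ‖k q‖} := by
        have : k p = 2 := div_mul_cancel₀ 2 hgp
        simp [this]
      have := denseRange_stoneCechUnit.open_subset_closure_inter hk hpk
      refine closure_mono ?_ this
      rintro _ ⟨hx, x, rfl⟩
      exact ⟨x, hx, rfl⟩

theorem isOpen_lambdaH (H : Ideal (X →ᵇ ℂ)) : IsOpen (lambdaH (H : Set (X →ᵇ ℂ))) := by
  rw [lambdaH_eq_setOfIdeal]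
  exact ContinuousMap.setOfIdeal_open _

theorem stoneCechRestrict_mem_iff {H : Ideal (X →ᵇ ℂ)} (hH : IsClosed (H : Set (X →ᵇ ℂ)))
    {g : C(StoneCech X, ℂ)} :
    stoneCechRestrict X g ∈ H ↔ ∀ p ∉ lambdaH (H : Set (X →ᵇ ℂ)), g p = 0 := by
  have hclosed : IsClosed (H.comap (stoneCechRestrict X) : Set C(StoneCech X, ℂ)) :=
    hH.preimage continuous_stoneCechRestrict
  rw [← Ideal.mem_comap, ← ContinuousMap.idealOfSet_ofIdeal_isClosed hclosed,
    ← lambdaH_eq_setOfIdeal, ContinuousMap.mem_idealOfSet]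
  rfl

theorem eq_iUnion_annihilator_iff {H : Ideal (X →ᵇ ℂ)} (hH : IsClosed (H : Set (X →ᵇ ℂ))) :
    (H : Set (X →ᵇ ℂ)) = ⋃ h ∈ H, {f : X →ᵇ ℂ | f * (h - 1) = 0} ↔
      ∀ f : C(StoneCech X, ℂ), (∀ p ∉ lambdaH (H : Set (X →ᵇ ℂ)), f p = 0) →
        ∃ g : C(StoneCech X, ℂ), (∀ p ∉ lambdaH (H : Set (X →ᵇ ℂ)), g p = 0) ∧
          f * (g - 1) = 0 := by
  have hsup : (⋃ h ∈ H, {f : X →ᵇ ℂ | f * (h - 1) = 0}) ⊆ H := iUnion₂_subset fun h hh f hf ↦ by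
    have hf' : f = f * h := by
      rw [mem_ofPred_eq, mul_sub, mul_one, sub_eq_zero] at hf
      exact hf.symm
    rw [hf']
    exact H.mul_mem_left f hh
  have hres : ∀ f g : C(StoneCech X, ℂ),
      stoneCechRestrict X f * (stoneCechRestrict X g - 1) = 0 ↔ f * (g - 1) = 0 := fun f g ↦ by
    rw [← map_one (stoneCechRestrict X), ← map_sub, ← map_mul,
      map_eq_zero_iff _ stoneCechRestrict_injective]
  have hmem : ∀ g : C(StoneCech X, ℂ), stoneCechRestrict X g ∈ H ↔
      ∀ p ∉ lambdaH (H : Set (X →ᵇ ℂ)), g p = 0 := fun g ↦ stoneCechRestrict_mem_iff hH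
  constructor
  · intro heq f hf
    have hfH : stoneCechRestrict X f ∈ (H : Set (X →ᵇ ℂ)) := (hmem f).2 hf
    rw [heq] at hfH
    obtain ⟨h, hh, hfh⟩ := mem_iUnion₂.1 hfH
    obtain ⟨g, rfl⟩ := stoneCechRestrict_surjective h
    exact ⟨g, (hmem g).1 hh, (hres f g).1 hfh⟩
  · refine fun hann ↦ Subset.antisymm (fun f hf ↦ ?_) hsup
    obtain ⟨f, rfl⟩ := stoneCechRestrict_surjective f
    obtain ⟨g, hg, hfg⟩ := hann f ((hmem f).1 hf)
    exact mem_iUnion₂.2 ⟨_, (hmem g).2 hg, (hres f g).2 hfg⟩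

end StoneCech

theorem stmt_10 {X : Type*} [TopologicalSpace X] [T35Space X]
    (H : Ideal (X →ᵇ ℂ)) (hclosed : IsClosed (H : Set (X →ᵇ ℂ)))
    (hnv : ∀ x : X, ∃ h ∈ H, h x ≠ 0) :
    -- (1) ↔ (2)
    ((∀ K ⊆ lambdaH (H : Set (X →ᵇ ℂ)), IsSigmaCompact K →
        ∃ L, L ⊆ lambdaH (H : Set (X →ᵇ ℂ)) ∧ IsCompact L ∧ K ⊆ L) ↔
      ({g : C(↥(lambdaH (H : Set (X →ᵇ ℂ))), ℂ) | HasCompactSupport (g : _ → ℂ)} =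
        {g : C(↥(lambdaH (H : Set (X →ᵇ ℂ))), ℂ) |
          Filter.Tendsto (g : _ → ℂ) (Filter.cocompact _) (nhds 0)})) ∧
    -- (2) ↔ (3)
    (({g : C(↥(lambdaH (H : Set (X →ᵇ ℂ))), ℂ) | HasCompactSupport (g : _ → ℂ)} =
        {g : C(↥(lambdaH (H : Set (X →ᵇ ℂ))), ℂ) |
          Filter.Tendsto (g : _ → ℂ) (Filter.cocompact _) (nhds 0)}) ↔
      (H : Set (X →ᵇ ℂ)) = ⋃ h ∈ H, {f : X →ᵇ ℂ | f * (h - 1) = 0}) ∧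
    -- in particular, (1) implies `λ_H X` is countably compact
    ((∀ K ⊆ lambdaH (H : Set (X →ᵇ ℂ)), IsSigmaCompact K →
        ∃ L, L ⊆ lambdaH (H : Set (X →ᵇ ℂ)) ∧ IsCompact L ∧ K ⊆ L) →
      IsCountablyCompactSet (lambdaH (H : Set (X →ᵇ ℂ)))) := by
  have hU := isOpen_lambdaH H
  have hset : {g : C(↥(lambdaH (H : Set (X →ᵇ ℂ))), ℂ) | HasCompactSupport (g : _ → ℂ)} =
        {g : C(↥(lambdaH (H : Set (X →ᵇ ℂ))), ℂ) |
          Filter.Tendsto (g : _ → ℂ) (Filter.cocompact _) (nhds 0)} ↔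
      ∀ g : C(↥(lambdaH (H : Set (X →ᵇ ℂ))), ℂ),
        Tendsto g (cocompact _) (𝓝 0) → HasCompactSupport g :=
    ⟨fun heq g hg ↦ heq.ge hg, fun h ↦
      Subset.antisymm (fun g hg ↦ HasCompactSupport.is_zero_at_infty hg) h⟩
  rw [hset, eq_iUnion_annihilator_iff hclosed]
  have hann := fun h₁ (f : C(StoneCech X, ℂ)) ↦
    exists_mul_sub_one_eq_zero_of_isSigmaCompact (f := f) hU h₁
  have hsupp := hasCompactSupport_of_exists_mul_sub_one_eq_zero hU
  have hcpt := fun h₂ S ↦ exists_isCompact_superset_of_hasCompactSupport (S := S) hU h₂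
  exact ⟨⟨fun h₁ ↦ hsupp (hann h₁), hcpt⟩, ⟨fun h₂ ↦ hann (hcpt h₂), hsupp⟩,
    isCountablyCompactSet_of_isSigmaCompact⟩
end
end
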